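/- arXiv:math/0612269 — 2 statements merged into one kernel-verified Lean document; each statement's English description precedes it below -/
import Mathlib

section
/- Let N₁ and N₂ be two norms on ℝ^n with N₁(x) ≤ N₂(x) for all x ∈ ℝ^n. Then ĥ⁰(N₁) ≥ ĥ⁰(N₂) and ĥ¹(N₁) ≤ ĥ¹(N₂); moreover χ̂(N₂) − χ̂(N₁) ≤ ĥ⁰(N₂) − ĥ⁰(N₁) + n·log 9 + 2·log(n!). -/
open MeasureTheory

/-- `N` is a norm on `ℝ^n`. -/
def IsNorm (n : ℕ) (N : (Fin n → ℝ) → ℝ) : Prop :=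
  (∀ x, N x = 0 ↔ x = 0) ∧ (∀ (c : ℝ) (x), N (c • x) = |c| * N x) ∧
    (∀ x y, N (x + y) ≤ N x + N y)

/-- `ĥ⁰(N) = log #(ℤ^n ∩ B(N))`. -/
noncomputable def h0Hat (n : ℕ) (N : (Fin n → ℝ) → ℝ) : ℝ :=
  Real.log (Nat.card {x : Fin n → ℤ // N (fun i => (x i : ℝ)) ≤ 1})

/-- `ĥ¹(N) = log #{x ∈ ℤ^n : |⟨x,y⟩| ≤ 1 for all y ∈ B(N)}`. -/
noncomputable def h1Hat (n : ℕ) (N : (Fin n → ℝ) → ℝ) : ℝ :=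
  Real.log (Nat.card {x : Fin n → ℤ //
    ∀ y : Fin n → ℝ, N y ≤ 1 → |∑ i, (x i : ℝ) * y i| ≤ 1})

/-- `χ̂(N) = log vol(B(N))`. -/
noncomputable def chiHat (n : ℕ) (N : (Fin n → ℝ) → ℝ) : ℝ :=
  Real.log (volume {x : Fin n → ℝ | N x ≤ 1}).toReal

namespace IsNorm

variable {n : ℕ} {N : (Fin n → ℝ) → ℝ}

lemma map_zero (h : IsNorm n N) : N 0 = 0 := (h.1 0).2 rfl

lemma map_neg (h : IsNorm n N) (x : Fin n → ℝ) : N (-x) = N x := by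
  have := h.2.1 (-1) x
  simpa using this

lemma nonneg (h : IsNorm n N) (x : Fin n → ℝ) : 0 ≤ N x := by
  have h1 := h.2.2 x (-x)
  rw [h.map_neg, add_neg_cancel, h.map_zero] at h1
  linarith

lemma map_sum_le (h : IsNorm n N) {ι : Type*} (s : Finset ι) (f : ι → Fin n → ℝ) :
    N (∑ i ∈ s, f i) ≤ ∑ i ∈ s, N (f i) :=
  Finset.le_sum_of_subadditive N h.map_zero.le h.2.2 s f

lemma exists_le_mul_norm (h : IsNorm n N) : ∃ C > 0, ∀ x, N x ≤ C * ‖x‖ := by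
  have h0 : 0 ≤ ∑ i, N (Pi.single i 1) := Finset.sum_nonneg fun i _ => h.nonneg _
  refine ⟨∑ i, N (Pi.single i 1) + 1, by positivity, fun x => ?_⟩
  calc N x = N (∑ i, x i • Pi.single i (1 : ℝ)) := by rw [← pi_eq_sum_univ' x]
    _ ≤ ∑ i, N (x i • Pi.single i (1 : ℝ)) := h.map_sum_le _ _
    _ ≤ ∑ i, N (Pi.single i 1) * ‖x‖ := by
        refine Finset.sum_le_sum fun i _ => ?_
        rw [h.2.1, mul_comm]
        exact mul_le_mul_of_nonneg_left (norm_le_pi_norm x i) (h.nonneg _)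
    _ ≤ _ := by
        rw [← Finset.sum_mul]
        gcongr
        linarith

lemma continuous (h : IsNorm n N) : Continuous N := by
  obtain ⟨C, hC, hN⟩ := h.exists_le_mul_norm
  refine (LipschitzWith.of_le_add_mul ⟨C, hC.le⟩ fun x y => ?_).continuous
  have h1 := h.2.2 y (x - y)
  rw [add_sub_cancel] at h1
  rw [dist_eq_norm]
  exact h1.trans (add_le_add_right (hN (x - y)) _)

lemma exists_mul_norm_le (h : IsNorm n N) : ∃ c > 0, ∀ x, c * ‖x‖ ≤ N x := by
  rcases (Metric.sphere (0 : Fin n → ℝ) 1).eq_empty_or_nonempty with he | hne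
  · refine ⟨1, one_pos, fun x => ?_⟩
    by_cases hx : x = 0
    · simp [hx, h.map_zero]
    · have : ‖x‖⁻¹ • x ∈ Metric.sphere (0 : Fin n → ℝ) 1 := by
        simp [norm_smul, norm_ne_zero_iff.2 hx]
      simp [he] at this
  · obtain ⟨z, hz, hmin⟩ := (isCompact_sphere (0 : Fin n → ℝ) 1).exists_isMinOn hne
      h.continuous.continuousOn
    have hz0 : z ≠ 0 := by
      rintro rfl
      simp at hz
    refine ⟨N z, (h.nonneg z).lt_of_ne fun h0 => hz0 ((h.1 z).1 h0.symm), fun x => ?_⟩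
    by_cases hx : x = 0
    · simp [hx, h.map_zero]
    · have hs : ‖x‖⁻¹ • x ∈ Metric.sphere (0 : Fin n → ℝ) 1 := by
        simp [norm_smul, norm_ne_zero_iff.2 hx]
      have h1 : N z ≤ N (‖x‖⁻¹ • x) := hmin hs
      rw [h.2.1, abs_of_nonneg (by positivity)] at h1
      have hp : 0 < ‖x‖ := norm_pos_iff.2 hx
      calc N z * ‖x‖ ≤ ‖x‖⁻¹ * N x * ‖x‖ := by gcongr
        _ = N x := by field_simp

lemma isBounded_unitBall (h : IsNorm n N) : Bornology.IsBounded {x | N x ≤ 1} := by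
  obtain ⟨c, hc, hN⟩ := h.exists_mul_norm_le
  refine isBounded_iff_forall_norm_le.2 ⟨1 / c, fun x hx => ?_⟩
  rw [le_div_iff₀' hc]
  exact (hN x).trans hx

lemma volume_unitBall_lt_top (h : IsNorm n N) : volume {x | N x ≤ 1} < ⊤ :=
  h.isBounded_unitBall.measure_lt_top

lemma volume_unitBall_pos (h : IsNorm n N) : 0 < volume {x | N x ≤ 1} := by
  refine lt_of_lt_of_le (IsOpen.measure_pos volume (isOpen_lt h.continuous continuous_const)
    ⟨0, ?_⟩) (measure_mono fun x (hx : N x < 1) => hx.le)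
  simp [h.map_zero]

open scoped Pointwise in
lemma volume_closedBall (h : IsNorm n N) {r : ℝ} (hr : 0 < r) :
    volume {x | N x ≤ r} = ENNReal.ofReal (r ^ n) * volume {x | N x ≤ 1} := by
  have : {x | N x ≤ r} = r • {x | N x ≤ 1} := by
    ext x
    rw [Set.mem_smul_set_iff_inv_smul_mem₀ hr.ne', Set.mem_ofPred_eq, Set.mem_ofPred_eq, h.2.1,
      abs_of_pos (inv_pos.2 hr), inv_mul_le_iff₀ hr, mul_one]
  rw [this, Measure.addHaar_smul, Module.finrank_fin_fun, abs_of_pos (pow_pos hr n)]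

end IsNorm

lemma finite_setOf_norm_intCast_le (n : ℕ) (R : ℝ) :
    {x : Fin n → ℤ | ∀ i, |(x i : ℝ)| ≤ R}.Finite := by
  refine (Set.finite_Icc (fun _ => -⌊R⌋) (fun _ => ⌊R⌋)).subset fun x hx => ?_
  have key : ∀ i, |x i| ≤ ⌊R⌋ := fun i => Int.le_floor.2 (by simpa using hx i)
  exact ⟨fun i => (abs_le.1 (key i)).1, fun i => (abs_le.1 (key i)).2⟩

namespace IsNorm

variable {n : ℕ} {N : (Fin n → ℝ) → ℝ}

lemma finite_lattice (h : IsNorm n N) :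
    {x : Fin n → ℤ | N (fun i => (x i : ℝ)) ≤ 1}.Finite := by
  obtain ⟨R, hR⟩ := isBounded_iff_forall_norm_le.1 h.isBounded_unitBall
  exact (finite_setOf_norm_intCast_le n R).subset fun x hx i =>
    (norm_le_pi_norm (fun i => (x i : ℝ)) i).trans (hR _ hx)

lemma finite_dual_lattice (h : IsNorm n N) :
    {x : Fin n → ℤ | ∀ y : Fin n → ℝ, N y ≤ 1 → |∑ i, (x i : ℝ) * y i| ≤ 1}.Finite := by
  obtain ⟨C, hC, hN⟩ := h.exists_le_mul_norm
  refine (finite_setOf_norm_intCast_le n C).subset fun x hx i => ?_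
  have h1 := hx (Pi.single i C⁻¹) ((hN _).trans (by
    rw [Pi.norm_single, Real.norm_of_nonneg (inv_pos.2 hC).le, mul_inv_cancel₀ hC.ne']))
  simp only [Pi.single_apply, mul_ite, mul_zero, Finset.sum_ite_eq', Finset.mem_univ,
    if_true, abs_mul, abs_of_pos (inv_pos.2 hC)] at h1
  rwa [mul_inv_le_iff₀ hC, one_mul] at h1

end IsNorm

/-- A packing bound: the translates of half the unit ball of `N₂` by the lattice points in the unit
ball of `N₁` cover each point at most `#(ℤ^n ∩ B(N₂))` times. -/
lemma card_mul_volume_le {n : ℕ} {N₁ N₂ : (Fin n → ℝ) → ℝ} (h₁ : IsNorm n N₁) (h₂ : IsNorm n N₂)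
    (hle : ∀ x, N₁ x ≤ N₂ x) :
    (Nat.card {x : Fin n → ℤ // N₁ (fun i => (x i : ℝ)) ≤ 1} : ENNReal) *
        volume {x | N₂ x ≤ 1 / 2} ≤
      Nat.card {x : Fin n → ℤ // N₂ (fun i => (x i : ℝ)) ≤ 1} * volume {x | N₁ x ≤ 3 / 2} := by
  classical
  set S := h₁.finite_lattice.toFinset with hS
  set T := h₂.finite_lattice.toFinset with hT
  have cS : Nat.card {x : Fin n → ℤ // N₁ (fun i => (x i : ℝ)) ≤ 1} = S.card :=
    Nat.card_eq_card_finite_toFinset h₁.finite_lattice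
  have cT : Nat.card {x : Fin n → ℤ // N₂ (fun i => (x i : ℝ)) ≤ 1} = T.card :=
    Nat.card_eq_card_finite_toFinset h₂.finite_lattice
  rw [cS, cT]
  let A : (Fin n → ℤ) → Set (Fin n → ℝ) := fun x => {z | N₂ (z - fun i => (x i : ℝ)) ≤ 1 / 2}
  have hA : ∀ x, MeasurableSet (A x) := fun x =>
    (isClosed_le (h₂.continuous.comp (continuous_id.sub continuous_const))
      continuous_const).measurableSet
  have hB : MeasurableSet {x | N₁ x ≤ 3 / 2} :=
    (isClosed_le h₁.continuous continuous_const).measurableSet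
  have vA : ∀ x, volume (A x) = volume {x | N₂ x ≤ 1 / 2} := fun x => by
    simp only [A, sub_eq_add_neg]
    exact measure_preimage_add_right volume (-fun i => (x i : ℝ)) {x | N₂ x ≤ 1 / 2}
  calc (S.card : ENNReal) * volume {x | N₂ x ≤ 1 / 2}
      = ∑ x ∈ S, volume (A x) := by simp [vA]
    _ = ∫⁻ z, ∑ x ∈ S, (A x).indicator 1 z := by
        rw [lintegral_finsetSum _ fun x _ => measurable_one.indicator (hA x)]
        exact Finset.sum_congr rfl fun x _ => (lintegral_indicator_one (hA x)).symm
    _ ≤ ∫⁻ z, {x | N₁ x ≤ 3 / 2}.indicator (fun _ => (T.card : ENNReal)) z := by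
        refine lintegral_mono fun z => ?_
        have hsum : ∑ x ∈ S, (A x).indicator (1 : (Fin n → ℝ) → ENNReal) z =
            ((S.filter fun x => z ∈ A x).card : ENNReal) := by
          simp [Set.indicator_apply]
        simp only [hsum]
        rcases (S.filter fun x => z ∈ A x).eq_empty_or_nonempty with he | ⟨x₀, hx₀⟩
        · simp [he]
        obtain ⟨hx₀S, hx₀A⟩ := Finset.mem_filter.1 hx₀
        have hx₀S : N₁ (fun i => (x₀ i : ℝ)) ≤ 1 := by simpa [hS] using hx₀S
        have hx₀A : N₂ (z - fun i => (x₀ i : ℝ)) ≤ 1 / 2 := hx₀A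
        have hz : z ∈ {x | N₁ x ≤ 3 / 2} := by
          have := h₁.2.2 (z - fun i => (x₀ i : ℝ)) (fun i => (x₀ i : ℝ))
          rw [sub_add_cancel] at this
          have := hle (z - fun i => (x₀ i : ℝ))
          rw [Set.mem_ofPred_eq]
          linarith
        rw [Set.indicator_of_mem hz]
        refine Nat.cast_le.2 (Finset.card_le_card_of_injOn (fun x => x - x₀) (fun x hx => ?_)
          (sub_left_injective.injOn))
        have hxA : N₂ (z - fun i => (x i : ℝ)) ≤ 1 / 2 := (Finset.mem_filter.1 hx).2
        have h3 := h₂.2.2 (z - fun i => (x₀ i : ℝ)) (-(z - fun i => (x i : ℝ)))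
        rw [h₂.map_neg] at h3
        have h4 : (z - fun i => (x₀ i : ℝ)) + -(z - fun i => (x i : ℝ)) =
            fun i => ((x - x₀) i : ℝ) := by
          ext i
          simp
        rw [h4] at h3
        have : N₂ (fun i => ((x - x₀) i : ℝ)) ≤ 1 := by linarith
        simpa [hT] using this
    _ = _ := lintegral_indicator_const hB _

/-- If `N₁ ≤ N₂` pointwise, then `ĥ⁰(N₁) ≥ ĥ⁰(N₂)`, `ĥ¹(N₁) ≤ ĥ¹(N₂)`, and
`χ̂(N₂) − χ̂(N₁) ≤ ĥ⁰(N₂) − ĥ⁰(N₁) + n·log 9 + 2·log(n!)`. -/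
theorem stmt3 (n : ℕ) (hn : 1 ≤ n) (N₁ N₂ : (Fin n → ℝ) → ℝ)
    (hN₁ : IsNorm n N₁) (hN₂ : IsNorm n N₂) (hle : ∀ x, N₁ x ≤ N₂ x) :
    h0Hat n N₁ ≥ h0Hat n N₂ ∧ h1Hat n N₁ ≤ h1Hat n N₂ ∧
      chiHat n N₂ - chiHat n N₁ ≤
        h0Hat n N₂ - h0Hat n N₁ + (n : ℝ) * Real.log 9 + 2 * Real.log (n.factorial) := by
  have hfin₁ := hN₁.finite_lattice.to_subtype
  have hfin₂ := hN₂.finite_lattice.to_subtype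
  have hfin₃ := hN₂.finite_dual_lattice.to_subtype
  have hfin₄ := hN₁.finite_dual_lattice.to_subtype
  have hz : (fun i : Fin n => (((0 : Fin n → ℤ) i : ℤ) : ℝ)) = 0 := by
    ext i
    simp
  have c₁ : 0 < Nat.card {x : Fin n → ℤ // N₁ (fun i => (x i : ℝ)) ≤ 1} :=
    Nat.card_pos_iff.2 ⟨⟨⟨0, by rw [hz, hN₁.map_zero]; exact zero_le_one⟩⟩, hfin₁⟩
  have c₂ : 0 < Nat.card {x : Fin n → ℤ // N₂ (fun i => (x i : ℝ)) ≤ 1} :=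
    Nat.card_pos_iff.2 ⟨⟨⟨0, by rw [hz, hN₂.map_zero]; exact zero_le_one⟩⟩, hfin₂⟩
  have c₃ : 0 < Nat.card {x : Fin n → ℤ //
      ∀ y : Fin n → ℝ, N₁ y ≤ 1 → |∑ i, (x i : ℝ) * y i| ≤ 1} :=
    Nat.card_pos_iff.2 ⟨⟨⟨0, by simp⟩⟩, hfin₄⟩
  refine ⟨?_, ?_, ?_⟩
  · refine Real.log_le_log (Nat.cast_pos.2 c₂) (Nat.cast_le.2 ?_)
    exact Nat.card_mono hN₁.finite_lattice fun x hx => (hle _).trans hx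
  · refine Real.log_le_log (Nat.cast_pos.2 c₃) (Nat.cast_le.2 ?_)
    exact Nat.card_mono hN₂.finite_dual_lattice fun x hx y hy => hx y ((hle y).trans hy)
  · have key := card_mul_volume_le hN₁ hN₂ hle
    rw [hN₂.volume_closedBall (by norm_num), hN₁.volume_closedBall (by norm_num)] at key
    have key' := ENNReal.toReal_mono (ENNReal.mul_ne_top (ENNReal.natCast_ne_top _)
      (ENNReal.mul_ne_top ENNReal.ofReal_ne_top hN₁.volume_unitBall_lt_top.ne)) key
    simp only [ENNReal.toReal_mul, ENNReal.toReal_natCast] at key'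
    rw [ENNReal.toReal_ofReal (by positivity), ENNReal.toReal_ofReal (by positivity)] at key'
    have v₁ := ENNReal.toReal_pos hN₁.volume_unitBall_pos.ne' hN₁.volume_unitBall_lt_top.ne
    have v₂ := ENNReal.toReal_pos hN₂.volume_unitBall_pos.ne' hN₂.volume_unitBall_lt_top.ne
    have d₁ : (0 : ℝ) < Nat.card {x : Fin n → ℤ // N₁ (fun i => (x i : ℝ)) ≤ 1} :=
      Nat.cast_pos.2 c₁
    have d₂ : (0 : ℝ) < Nat.card {x : Fin n → ℤ // N₂ (fun i => (x i : ℝ)) ≤ 1} :=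
      Nat.cast_pos.2 c₂
    have hlog := Real.log_le_log (by positivity) key'
    rw [Real.log_mul (by positivity) (by positivity), Real.log_mul (by positivity) (by positivity),
      Real.log_mul (by positivity) (by positivity), Real.log_mul (by positivity) (by positivity),
      Real.log_pow, Real.log_pow, Real.log_div (by norm_num) (by norm_num),
      Real.log_div (by norm_num) (by norm_num), Real.log_one] at hlog
    have h39 : (n : ℝ) * Real.log 3 ≤ n * Real.log 9 := by
      gcongr
      norm_num
    have hfac : 0 ≤ Real.log (n.factorial) := Real.log_natCast_nonneg _
    unfold chiHat h0Hat
    linarith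
end

section
/- Let K ⊆ ℝ^n be a bounded convex centrally symmetric body with 0 in its interior, and suppose f is a real number with 0 < f ≤ V(K)·V(K*). Then for every real number a > 1, M(K) ≤ M(aK) ≤ a^n · M(K) · 36^n / f, where aK = {a·x : x ∈ K}. -/
open MeasureTheory Pointwise

/-- `M(K)`: the number of integer lattice points in `K ⊆ ℝ^n`. -/
noncomputable def latticeCount (n : ℕ) (K : Set (Fin n → ℝ)) : ℕ :=
  Nat.card {x : Fin n → ℤ // (fun i => (x i : ℝ)) ∈ K}

/-- The polar body `K* = {x : |⟨x,y⟩| ≤ 1 for all y ∈ K}`. -/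
def polarBody (n : ℕ) (K : Set (Fin n → ℝ)) : Set (Fin n → ℝ) :=
  {x | ∀ y ∈ K, |∑ i, x i * y i| ≤ 1}

/-- A bounded set contains only finitely many lattice points. -/
lemma finite_lattice_points {n : ℕ} {K : Set (Fin n → ℝ)} (hK : Bornology.IsBounded K) :
    {x : Fin n → ℤ | (fun i => (x i : ℝ)) ∈ K}.Finite := by
  obtain ⟨R, hR⟩ := hK.subset_closedBall 0
  refine (Set.finite_Icc (fun _ : Fin n => -⌈R⌉) (fun _ => ⌈R⌉)).subset fun x hx => ?_
  have h := mem_closedBall_zero_iff.1 (hR hx)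
  have hi : ∀ i, |(x i : ℝ)| ≤ ⌈R⌉ := fun i =>
    (norm_le_pi_norm (fun i => (x i : ℝ)) i).trans (h.trans (Int.le_ceil R))
  refine ⟨fun i => ?_, fun i => ?_⟩
  · exact_mod_cast (abs_le.1 (hi i)).1
  · exact_mod_cast (abs_le.1 (hi i)).2

lemma latticeCount_mono {n : ℕ} {K L : Set (Fin n → ℝ)} (hL : Bornology.IsBounded L)
    (h : K ⊆ L) : latticeCount n K ≤ latticeCount n L :=
  Nat.card_mono (finite_lattice_points hL) fun _ hx => h hx

/-- The cube `[-1, 1]ⁿ` has volume `2ⁿ`. -/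
lemma volume_Icc_neg_one_one (n : ℕ) :
    volume (Set.Icc (fun _ : Fin n => (-1 : ℝ)) (fun _ => 1)) = ENNReal.ofReal (2 ^ n) := by
  rw [Real.volume_Icc_pi, ENNReal.ofReal_pow (by norm_num)]
  norm_num

/-- A bounded set with nonempty interior around the origin has an Auerbach-type basis in its
closure, encoded as the rows of a matrix maximising the determinant. -/
lemma exists_maximal_det {n : ℕ} {K : Set (Fin n → ℝ)} (hK : Bornology.IsBounded K)
    (hK0 : (0 : Fin n → ℝ) ∈ interior K) :
    ∃ A : Matrix (Fin n) (Fin n) ℝ, (∀ i, A i ∈ closure K) ∧ A.det ≠ 0 ∧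
      ∀ y ∈ closure K, ∀ i, |(A.updateRow i y).det| ≤ |A.det| := by
  have hcpt : IsCompact (Set.univ.pi fun _ : Fin n => closure K) :=
    isCompact_univ_pi fun _ => hK.isCompact_closure
  have h0 : (0 : Fin n → ℝ) ∈ closure K := subset_closure (interior_subset hK0)
  obtain ⟨A, hA, hmax⟩ := hcpt.exists_isMaxOn ⟨fun _ => 0, fun _ _ => h0⟩
    (f := fun A : Fin n → Fin n → ℝ => |(Matrix.of A).det|)
    (Continuous.continuousOn (by
      exact (Continuous.matrix_det continuous_id).abs))
  refine ⟨A, fun i => hA i trivial, ?_, fun y hy i => ?_⟩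
  · obtain ⟨r, hr, hball⟩ := Metric.mem_nhds_iff.1 (mem_interior_iff_mem_nhds.1 hK0)
    have hmem : (fun i => Pi.single i (r / 2) : Fin n → Fin n → ℝ) ∈
        Set.univ.pi fun _ : Fin n => closure K := by
      intro i _
      refine subset_closure (hball ?_)
      rw [mem_ball_zero_iff, pi_norm_lt_iff hr]
      intro j
      by_cases hij : j = i
      · subst hij
        simp only [Pi.single_eq_same, Real.norm_eq_abs]
        rw [abs_of_pos (by positivity)]
        linarith
      · simpa [Pi.single_eq_of_ne hij] using hr
    have h := hmax hmem
    have hdiag : (Matrix.of fun i => Pi.single i (r / 2) : Matrix (Fin n) (Fin n) ℝ) =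
        Matrix.diagonal fun _ => r / 2 := by
      ext i j
      simp [Matrix.diagonal_apply, Pi.single_apply, eq_comm]
    simp only [Set.mem_ofPred_eq, hdiag, Matrix.det_diagonal, Finset.prod_const] at h
    have hpos : 0 < |(r / 2) ^ (Finset.univ : Finset (Fin n)).card| := by positivity
    exact abs_pos.1 (hpos.trans_le h)
  · refine hmax (a := Function.update A i y) fun j _ => ?_
    by_cases hj : j = i
    · subst hj
      simpa using hy
    · simpa [Function.update_of_ne hj] using hA j trivial

lemma polarBody_closure {n : ℕ} (K : Set (Fin n → ℝ)) {x y : Fin n → ℝ}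
    (hx : x ∈ polarBody n K) (hy : y ∈ closure K) : |∑ i, x i * y i| ≤ 1 := by
  have hclosed : IsClosed {y : Fin n → ℝ | |∑ i, x i * y i| ≤ 1} :=
    isClosed_le (by fun_prop) continuous_const
  exact closure_minimal (fun y hy => hx y hy) hclosed hy

/-- A crude form of the Blaschke–Santaló inequality. -/
lemma volume_mul_volume_polarBody_le {n : ℕ} {K : Set (Fin n → ℝ)}
    (hK : Bornology.IsBounded K) (hK0 : (0 : Fin n → ℝ) ∈ interior K) :
    (volume K).toReal * (volume (polarBody n K)).toReal ≤ 4 ^ n := by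
  obtain ⟨A, hA, hdet, hmax⟩ := exists_maximal_det hK hK0
  set Q := Set.Icc (fun _ : Fin n => (-1 : ℝ)) (fun _ => 1)
  have hsub : K ⊆ Matrix.toLin' A.transpose '' Q := by
    intro y hy
    refine ⟨A.det⁻¹ • Matrix.cramer A.transpose y, ?_, ?_⟩
    · have hi : ∀ i, |(A.det⁻¹ • Matrix.cramer A.transpose y) i| ≤ 1 := fun i => by
        rw [Pi.smul_apply, Matrix.cramer_transpose_apply, smul_eq_mul, abs_mul, abs_inv,
          inv_mul_le_one₀ (abs_pos.2 hdet)]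
        exact hmax y (subset_closure hy) i
      exact ⟨fun i => (abs_le.1 (hi i)).1, fun i => (abs_le.1 (hi i)).2⟩
    · rw [Matrix.toLin'_apply, Matrix.mulVec_smul, Matrix.mulVec_cramer, Matrix.det_transpose,
        smul_smul, inv_mul_cancel₀ hdet, one_smul]
  have hpolar : polarBody n K ⊆ Matrix.toLin' A ⁻¹' Q := by
    intro x hx
    have hi : ∀ i, |Matrix.toLin' A x i| ≤ 1 := fun i => by
      have h := polarBody_closure K hx (hA i)
      simpa [Matrix.toLin'_apply, Matrix.mulVec, dotProduct, mul_comm] using h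
    exact ⟨fun i => (abs_le.1 (hi i)).1, fun i => (abs_le.1 (hi i)).2⟩
  have hV : (volume K).toReal ≤ |A.det| * 2 ^ n := by
    refine ENNReal.toReal_le_of_le_ofReal (by positivity) ((measure_mono hsub).trans_eq ?_)
    rw [Measure.addHaar_image_linearMap, LinearMap.det_toLin', Matrix.det_transpose,
      volume_Icc_neg_one_one, ENNReal.ofReal_mul (abs_nonneg _)]
  have hP : (volume (polarBody n K)).toReal ≤ |A.det|⁻¹ * 2 ^ n := by
    refine ENNReal.toReal_le_of_le_ofReal (by positivity) ((measure_mono hpolar).trans_eq ?_)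
    rw [Measure.addHaar_preimage_linearMap _ (by rwa [LinearMap.det_toLin']),
      LinearMap.det_toLin', volume_Icc_neg_one_one, ← abs_inv,
      ENNReal.ofReal_mul (abs_nonneg _)]
  calc (volume K).toReal * (volume (polarBody n K)).toReal
      ≤ (|A.det| * 2 ^ n) * (|A.det|⁻¹ * 2 ^ n) := by gcongr
    _ = |A.det| * |A.det|⁻¹ * (2 * 2) ^ n := by rw [mul_pow]; ring
    _ = 4 ^ n := by rw [mul_inv_cancel₀ (abs_pos.2 hdet).ne']; norm_num

/-- Translates of the half body `(1/2)K` contain at most `M(K)` lattice points. -/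
lemma card_filter_half_translate_le {n : ℕ} {K : Set (Fin n → ℝ)}
    (hK : Bornology.IsBounded K) (hconv : Convex ℝ K) (hsymm : K = -K)
    (S : Finset (Fin n → ℤ)) (x : Fin n → ℝ)
    (hS : ∀ z ∈ S, x ∈ (fun i => (z i : ℝ)) +ᵥ (1 / 2 : ℝ) • K) :
    S.card ≤ latticeCount n K := by
  rcases S.eq_empty_or_nonempty with rfl | ⟨w, hw⟩
  · simp
  have hmaps : (fun z => z - w) '' (S : Set (Fin n → ℤ)) ⊆
      {z : Fin n → ℤ | (fun i => (z i : ℝ)) ∈ K} := by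
    rintro _ ⟨z, hz, rfl⟩
    obtain ⟨_, ⟨k, hk, rfl⟩, hkx⟩ := hS z hz
    obtain ⟨_, ⟨l, hl, rfl⟩, hlx⟩ := hS w hw
    have hk' : -k ∈ K := by rw [hsymm]; simpa using hk
    have h := hconv hl hk' (a := 1 / 2) (b := 1 / 2) (by norm_num) (by norm_num) (by norm_num)
    change (fun i => ((z - w) i : ℝ)) ∈ K
    convert h using 1
    ext i
    have h1 := congrFun hkx i
    have h2 := congrFun hlx i
    simp only [vadd_eq_add, Pi.add_apply, Pi.smul_apply, smul_eq_mul, Pi.neg_apply,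
      Pi.sub_apply, Int.cast_sub] at h1 h2 ⊢
    linarith
  have hcard := Set.ncard_le_ncard hmaps (finite_lattice_points hK)
  rw [Set.ncard_image_of_injective _ sub_left_injective, Set.ncard_coe_finset] at hcard
  exact hcard

/-- Dilating a symmetric convex body by `a` multiplies its lattice point count by at most
`(2a + 1)ⁿ`. -/
lemma latticeCount_smul_le {n : ℕ} {K : Set (Fin n → ℝ)}
    (hK : Bornology.IsBounded K) (hconv : Convex ℝ K) (hsymm : K = -K)
    (hK0 : (0 : Fin n → ℝ) ∈ interior K) {a : ℝ} (ha : 0 ≤ a) :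
    (latticeCount n (a • K) : ℝ) ≤ (2 * a + 1) ^ n * latticeCount n K := by
  classical
  have hfin := finite_lattice_points (hK.smul₀ a)
  set S := hfin.toFinset with hSdef
  have hcardS : latticeCount n (a • K) = S.card := Nat.card_eq_card_finite_toFinset hfin
  let T : (Fin n → ℤ) → Set (Fin n → ℝ) := fun z => (fun i => (z i : ℝ)) +ᵥ (1 / 2 : ℝ) • K
  have hTmeas : ∀ z, NullMeasurableSet (T z) := fun z =>
    ((hconv.smul _).vadd _).nullMeasurableSet volume
  have hDmeas : NullMeasurableSet ((a + 1 / 2) • K) := (hconv.smul _).nullMeasurableSet volume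
  have hTsub : ∀ z ∈ S, T z ⊆ (a + 1 / 2) • K := by
    intro z hz x hx
    rw [hconv.add_smul ha (by norm_num)]
    obtain ⟨k, hk, rfl⟩ := hx
    exact Set.add_mem_add (hfin.mem_toFinset.1 hz) hk
  have hpoint : ∀ x, ∑ z ∈ S, (T z).indicator (fun _ => (1 : ENNReal)) x ≤
      ((a + 1 / 2) • K).indicator (fun _ => (latticeCount n K : ENNReal)) x := by
    intro x
    by_cases hx : x ∈ (a + 1 / 2) • K
    · rw [Set.indicator_of_mem hx]
      simp only [Set.indicator_apply]
      rw [Finset.sum_boole]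
      exact_mod_cast card_filter_half_translate_le hK hconv hsymm _ x
        fun z hz => (Finset.mem_filter.1 hz).2
    · rw [Finset.sum_eq_zero fun z hz => Set.indicator_of_notMem (fun h => hx (hTsub z hz h)) _]
      exact zero_le
  have hint := lintegral_mono (μ := volume) hpoint
  rw [lintegral_finsetSum' _ fun z _ => (aemeasurable_const.indicator₀ (hTmeas z))] at hint
  simp only [lintegral_indicator_const₀ (hTmeas _), lintegral_indicator_const₀ hDmeas, one_mul,
    T, measure_vadd, Finset.sum_const, nsmul_eq_mul, Measure.addHaar_smul,
    Module.finrank_fin_fun] at hint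
  have hVpos : 0 < (volume K).toReal :=
    ENNReal.toReal_pos (Measure.measure_pos_of_mem_nhds volume (mem_interior_iff_mem_nhds.1 hK0)).ne'
      hK.measure_lt_top.ne
  have hreal := ENNReal.toReal_mono (by
    exact ENNReal.mul_ne_top (by simp) (ENNReal.mul_ne_top (by simp) hK.measure_lt_top.ne)) hint
  simp only [ENNReal.toReal_mul, ENNReal.toReal_natCast,
    ENNReal.toReal_ofReal (abs_nonneg _)] at hreal
  rw [abs_of_nonneg (by positivity), abs_of_nonneg (by positivity), ← mul_assoc, ← mul_assoc,
    mul_le_mul_iff_left₀ hVpos] at hreal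
  rw [hcardS]
  calc (S.card : ℝ) = 2 ^ n * (S.card * (1 / 2) ^ n) := by
        rw [mul_left_comm, ← mul_pow]; norm_num
    _ ≤ 2 ^ n * (latticeCount n K * (a + 1 / 2) ^ n) := by gcongr
    _ = (2 * (a + 1 / 2)) ^ n * latticeCount n K := by rw [mul_pow]; ring
    _ = (2 * a + 1) ^ n * latticeCount n K := by ring_nf

/-- For a bounded convex centrally symmetric body `K ⊆ ℝ^n` with `0` in its interior,
`0 < f ≤ V(K)·V(K*)`, and any real `a > 1`: `M(K) ≤ M(aK) ≤ aⁿ·M(K)·36ⁿ/f`. -/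
theorem stmt8 (n : ℕ) (hn : 1 ≤ n) (K : Set (Fin n → ℝ))
    (hKbd : Bornology.IsBounded K) (hKconv : Convex ℝ K) (hKsymm : K = -K)
    (hK0 : (0 : Fin n → ℝ) ∈ interior K)
    (f : ℝ) (hf : 0 < f)
    (hfK : f ≤ (volume K).toReal * (volume (polarBody n K)).toReal)
    (a : ℝ) (ha : 1 < a) :
    (latticeCount n K : ℝ) ≤ (latticeCount n (a • K) : ℝ) ∧
      (latticeCount n (a • K) : ℝ) ≤ a ^ n * (latticeCount n K : ℝ) * 36 ^ n / f := by
  have hsub : K ⊆ a • K := fun x hx => by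
    refine ⟨a⁻¹ • x, ?_, smul_inv_smul₀ (by positivity) x⟩
    exact hKconv.smul_mem_of_zero_mem (interior_subset hK0) hx
      ⟨by positivity, inv_le_one_of_one_le₀ ha.le⟩
  refine ⟨by exact_mod_cast latticeCount_mono (hKbd.smul₀ a) hsub, ?_⟩
  have hf4 : f ≤ 4 ^ n := hfK.trans (volume_mul_volume_polarBody_le hKbd hK0)
  rw [le_div_iff₀ hf]
  calc (latticeCount n (a • K) : ℝ) * f
      ≤ ((2 * a + 1) ^ n * latticeCount n K) * 4 ^ n :=
        mul_le_mul (latticeCount_smul_le hKbd hKconv hKsymm hK0 (by positivity)) hf4 hf.le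
          (by positivity)
    _ = (4 * (2 * a + 1)) ^ n * latticeCount n K := by rw [mul_pow]; ring
    _ ≤ (36 * a) ^ n * latticeCount n K := by
        gcongr ?_ ^ n * _
        linarith
    _ = a ^ n * latticeCount n K * 36 ^ n := by rw [mul_pow]; ring
end
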